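/- Let p be a prime, d ≥ 1, q = p^d, n ≥ 1, and let K be a field. With 𝔽_q = GaloisField p d and 𝔤 = Matrix (Fin n) (Fin n) 𝔽_q, let ρ : GL_n(DualNumber 𝔽_q) → GL_n(𝔽_q) and ρ' : GL_n(TruncatedWittVector p 2 𝔽_q) → GL_n(𝔽_q) be the reduction homomorphisms and σ : GL_n(𝔽_q) → GL_n(𝔽_q) the entrywise p-th power automorphism. Fix an additive character χ : 𝔤 → K. Let H₂ = {g ∈ GL_n(DualNumber 𝔽_q) : ∀ X ∈ 𝔤, χ(ρ(g)⁻¹ X ρ(g)) = χ(X)} and H'₂ = {g ∈ GL_n(TruncatedWittVector p 2 𝔽_q) : ∀ X ∈ 𝔤, χ(σ(ρ'(g))⁻¹ X σ(ρ'(g))) = χ(X)} be the stabilizer subgroups of χ. Then ρ'(H'₂) = σ⁻¹(ρ(H₂)) as subgroups of GL_n(𝔽_q); in particular, the quotients H₂/ker(ρ) and H'₂/ker(ρ') are isomorphic as groups. -/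

import Mathlib

open Matrix

noncomputable def wittRed (p : ℕ) [Fact p.Prime] (R : Type*) [CommRing R] :
    TruncatedWittVector p 2 R →+* R where
  toFun x := x.coeff 0
  map_one' := by
    show TruncatedWittVector.coeff 0 (1 : TruncatedWittVector p 2 R) = 1
    rw [← map_one (WittVector.truncate (p := p) (R := R) 2), WittVector.coeff_truncate]
    simp
  map_zero' := by
    show TruncatedWittVector.coeff 0 (0 : TruncatedWittVector p 2 R) = 0
    rw [← map_zero (WittVector.truncate (p := p) (R := R) 2), WittVector.coeff_truncate]
    simp
  map_mul' := by
    intro x y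
    obtain ⟨a, ha⟩ := WittVector.truncate_surjective (p := p) 2 R x
    obtain ⟨b, hb⟩ := WittVector.truncate_surjective (p := p) 2 R y
    show TruncatedWittVector.coeff 0 (x * y) =
      TruncatedWittVector.coeff 0 x * TruncatedWittVector.coeff 0 y
    rw [← ha, ← hb, ← _root_.map_mul, WittVector.coeff_truncate, WittVector.coeff_truncate,
      WittVector.coeff_truncate]
    exact WittVector.mul_coeff_zero a b
  map_add' := by
    intro x y
    obtain ⟨a, ha⟩ := WittVector.truncate_surjective (p := p) 2 R x
    obtain ⟨b, hb⟩ := WittVector.truncate_surjective (p := p) 2 R y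
    show TruncatedWittVector.coeff 0 (x + y) =
      TruncatedWittVector.coeff 0 x + TruncatedWittVector.coeff 0 y
    rw [← ha, ← hb, ← _root_.map_add, WittVector.coeff_truncate, WittVector.coeff_truncate,
      WittVector.coeff_truncate]
    exact WittVector.add_coeff_zero a b

noncomputable def dualRed (R : Type*) [CommRing R] : DualNumber R →+* R :=
  (TrivSqZeroExt.fstHom R R R).toRingHom

/-- The stabilizer in `GLₙ(F)` of an additive character `χ` of `Mₙ(F)` under the adjoint
(conjugation) action. -/
def addCharStabilizer (n : ℕ) (F : Type*) [Field F] (K : Type*) [Field K]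
    (χ : AddChar (Matrix (Fin n) (Fin n) F) K) : Subgroup (GL (Fin n) F) where
  carrier := {g | ∀ X : Matrix (Fin n) (Fin n) F,
    χ ((↑(g⁻¹) : Matrix (Fin n) (Fin n) F) * X * (↑g : Matrix (Fin n) (Fin n) F)) = χ X}
  one_mem' := by intro X; simp
  mul_mem' := by
    intro a b ha hb X
    have h : (↑((a * b)⁻¹) : Matrix (Fin n) (Fin n) F) * X * (↑(a * b) : Matrix (Fin n) (Fin n) F)
        = (↑(b⁻¹) : Matrix (Fin n) (Fin n) F) *
            ((↑(a⁻¹) : Matrix (Fin n) (Fin n) F) * X * (↑a : Matrix (Fin n) (Fin n) F)) *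
            (↑b : Matrix (Fin n) (Fin n) F) := by
      rw [_root_.mul_inv_rev]
      simp [Units.val_mul, mul_assoc]
    rw [h, hb, ha]
  inv_mem' := by
    intro a ha X
    have h := ha ((↑a : Matrix (Fin n) (Fin n) F) * X * (↑(a⁻¹) : Matrix (Fin n) (Fin n) F))
    have h2 : (↑(a⁻¹) : Matrix (Fin n) (Fin n) F) *
        ((↑a : Matrix (Fin n) (Fin n) F) * X * (↑(a⁻¹) : Matrix (Fin n) (Fin n) F)) *
        (↑a : Matrix (Fin n) (Fin n) F) = X := by
      have hinv : (↑(a⁻¹) : Matrix (Fin n) (Fin n) F) * (↑a : Matrix (Fin n) (Fin n) F) = 1 := by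
        rw [← Units.val_mul, inv_mul_cancel a, Units.val_one]
      calc (↑(a⁻¹) : Matrix (Fin n) (Fin n) F) *
            ((↑a : Matrix (Fin n) (Fin n) F) * X * (↑(a⁻¹) : Matrix (Fin n) (Fin n) F)) *
            (↑a : Matrix (Fin n) (Fin n) F)
          = ((↑(a⁻¹) : Matrix (Fin n) (Fin n) F) * (↑a : Matrix (Fin n) (Fin n) F)) * X *
            ((↑(a⁻¹) : Matrix (Fin n) (Fin n) F) * (↑a : Matrix (Fin n) (Fin n) F)) := by
            noncomm_ring
        _ = X := by rw [hinv]; simp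
    rw [h2] at h
    exact h.symm

theorem Matrix.GeneralLinearGroup.map_surjective {m R S : Type*} [Fintype m] [DecidableEq m]
    [CommRing R] [CommRing S] (f : R →+* S) [IsLocalHom f] (hf : Function.Surjective f) :
    Function.Surjective (Matrix.GeneralLinearGroup.map (n := m) f) := by
  intro g
  choose lift hlift using hf
  let A : Matrix m m R := (g : Matrix m m S).map lift
  have hA : f.mapMatrix A = g := by
    ext i j
    exact hlift _
  have hdet : IsUnit A.det := by
    apply isUnit_of_map_unit f
    rw [RingHom.map_det, hA]
    exact (Matrix.isUnit_iff_isUnit_det _).1 g.isUnit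
  exact ⟨Matrix.GeneralLinearGroup.mk'' A hdet, Units.ext hA⟩

theorem Matrix.GeneralLinearGroup.map_injective {m R S : Type*} [Fintype m] [DecidableEq m]
    [CommRing R] [CommRing S] (f : R →+* S) (hf : Function.Injective f) :
    Function.Injective (Matrix.GeneralLinearGroup.map (n := m) f) :=
  Units.map_injective (Matrix.map_injective hf)

theorem dualRed_surjective (R : Type*) [CommRing R] : Function.Surjective (dualRed R) :=
  fun r => ⟨TrivSqZeroExt.inl r, rfl⟩

instance isLocalHom_dualRed (R : Type*) [CommRing R] : IsLocalHom (dualRed R) :=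
  ⟨fun _ hx => TrivSqZeroExt.isUnit_iff_isUnit_fst.2 hx⟩

theorem wittRed_truncate (p : ℕ) [Fact p.Prime] {R : Type*} [CommRing R] (x : WittVector p R) :
    wittRed p R (WittVector.truncate 2 x) = x.coeff 0 :=
  WittVector.coeff_truncate x 0

theorem wittRed_surjective (p : ℕ) [Fact p.Prime] (R : Type*) [CommRing R] :
    Function.Surjective (wittRed p R) := fun r =>
  ⟨WittVector.truncate 2 (WittVector.teichmuller p r), by
    rw [wittRed_truncate, WittVector.teichmuller_coeff_zero]⟩

instance isLocalHom_wittRed (p : ℕ) [Fact p.Prime] (k : Type*) [Field k] [CharP k p] :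
    IsLocalHom (wittRed p k) where
  map_nonunit x hx := by
    obtain ⟨a, rfl⟩ := WittVector.truncate_surjective (p := p) 2 k x
    rw [wittRed_truncate] at hx
    exact (WittVector.isUnit_of_coeff_zero_ne_zero a hx.ne_zero).map _

/-- The quotient of the preimage of `S` under a surjection by the kernel is `S`. -/
noncomputable def quotientKerComapEquiv {G A : Type*} [Group G] [Group A] (f : G →* A)
    (hf : Function.Surjective f) (S : Subgroup A) :
    (S.comap f ⧸ f.ker.subgroupOf (S.comap f)) ≃* S :=
  (QuotientGroup.quotientMulEquivOfEq (by
    ext x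
    exact (Subtype.ext_iff (a1 := f.subgroupComap S x) (a2 := 1)).symm)).trans
    (QuotientGroup.quotientKerEquivOfSurjective (f.subgroupComap S)
      (f.subgroupComap_surjective_of_surjective S hf))

/-- **Lemma 3.3 for `GLₙ`.** The stabilizers `H₂ ≤ GLₙ(𝔽_q[t]/t²)` and
`H'₂ ≤ GLₙ(W₂(𝔽_q))` of an additive character `χ` of `𝔤 = Mₙ(𝔽_q)` satisfy
`ρ'(H'₂) = σ⁻¹(ρ(H₂))`; in particular `H₂/ker ρ ≅ H'₂/ker ρ'`. -/
theorem stabilizers_agree_GL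
    (p d n : ℕ) [Fact p.Prime] (hd : 1 ≤ d) (hn : 1 ≤ n) (q : ℕ) (hq : q = p ^ d)
    (K : Type*) [Field K]
    (ρ : GL (Fin n) (DualNumber (GaloisField p d)) →* GL (Fin n) (GaloisField p d))
    (hρ : ρ = Matrix.GeneralLinearGroup.map (dualRed (GaloisField p d)))
    (ρ' : GL (Fin n) (TruncatedWittVector p 2 (GaloisField p d)) →*
      GL (Fin n) (GaloisField p d))
    (hρ' : ρ' = Matrix.GeneralLinearGroup.map (wittRed p (GaloisField p d)))
    (σ : GL (Fin n) (GaloisField p d) →* GL (Fin n) (GaloisField p d))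
    (hσ : σ = Matrix.GeneralLinearGroup.map (frobenius (GaloisField p d) p))
    (χ : AddChar (Matrix (Fin n) (Fin n) (GaloisField p d)) K)
    (H₂ : Subgroup (GL (Fin n) (DualNumber (GaloisField p d))))
    (hH₂ : H₂ = Subgroup.comap ρ (addCharStabilizer n (GaloisField p d) K χ))
    (H'₂ : Subgroup (GL (Fin n) (TruncatedWittVector p 2 (GaloisField p d))))
    (hH'₂ : H'₂ = Subgroup.comap (σ.comp ρ') (addCharStabilizer n (GaloisField p d) K χ)) :
    Subgroup.map ρ' H'₂ = Subgroup.comap σ (Subgroup.map ρ H₂) ∧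
      Nonempty ((H₂ ⧸ (MonoidHom.ker ρ).subgroupOf H₂) ≃*
        (H'₂ ⧸ (MonoidHom.ker ρ').subgroupOf H'₂)) := by
  subst hρ hρ' hσ hH₂ hH'₂
  set S := addCharStabilizer n (GaloisField p d) K χ
  set ρ := Matrix.GeneralLinearGroup.map (n := Fin n) (dualRed (GaloisField p d))
  set ρ' := Matrix.GeneralLinearGroup.map (n := Fin n) (wittRed p (GaloisField p d))
  set σ := Matrix.GeneralLinearGroup.map (n := Fin n) (frobenius (GaloisField p d) p)
  have hρ : Function.Surjective ρ :=
    Matrix.GeneralLinearGroup.map_surjective _ (dualRed_surjective _)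
  have hρ' : Function.Surjective ρ' :=
    Matrix.GeneralLinearGroup.map_surjective _ (wittRed_surjective p _)
  have hσ : Function.Injective σ :=
    Matrix.GeneralLinearGroup.map_injective _ (frobenius_inj _ p)
  have hσ' : Function.Surjective σ := Finite.surjective_of_injective hσ
  constructor
  · rw [← Subgroup.comap_comap, Subgroup.map_comap_eq_self_of_surjective hρ',
      Subgroup.map_comap_eq_self_of_surjective hρ]
  · exact ⟨(quotientKerComapEquiv ρ hρ S).trans <|
      (quotientKerComapEquiv (σ.comp ρ') (hσ'.comp hρ') S).symm.trans <|
        QuotientGroup.quotientMulEquivOfEq (by rw [MonoidHom.ker_comp_of_injective ρ' σ hσ])⟩
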